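/- Let G be a finite group, S a set of subgroups of G closed under conjugation, and O_S the orbit category with object set S and morphisms the G-maps G/H → G/K. The skeletal weighting of O_S is given by k(H) = −μ_{S₊}(H, ∞)/[G:H], where S₊ is the poset S with an added maximum element ∞ and μ is its Möbius function. Equivalently, k(H) = −χ̃(S_{>H})/[G:H], where χ̃ is the reduced Euler characteristic of the order complex of the subposet of subgroups in S strictly containing H. -/

import Mathlib

open scoped Classical

/-- The reduced Euler characteristic of (the order complex of) a poset `P`:
`χ̃(P) = −1 + Σ_{d≥0} (−1)^d · #{strictly increasing chains of d+1 elements}`.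
For a poset `P₊` obtained from `P` by adding a maximum `∞`, one has
`−μ_{P₊}(H, ∞) = −χ̃(P_{>H})` for `H ∈ P`; this is the classical equivalence
used in the statement. -/
noncomputable def reducedEuler (P : Type*) [Preorder P] : ℚ :=
  -1 + ∑ᶠ d : ℕ, (-1 : ℚ) ^ d * (Nat.card { f : Fin (d + 1) → P // StrictMono f } : ℚ)

/-- The conjugate subgroup `gHg⁻¹`. -/
def conjSub {G : Type*} [Group G] (H : Subgroup G) (g : G) : Subgroup G :=
  H.map (MulAut.conj g).toMonoidHom

theorem reducedEuler_congr {P Q : Type*} [Preorder P] [Preorder Q] (e : P ≃o Q) :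
    reducedEuler P = reducedEuler Q := by
  have h (n : ℕ) : Nat.card { f : Fin n → P // StrictMono f } =
      Nat.card { f : Fin n → Q // StrictMono f } :=
    Nat.card_congr
      { toFun := fun f => ⟨fun i => e (f.1 i), e.strictMono.comp f.2⟩
        invFun := fun f => ⟨fun i => e.symm (f.1 i), e.symm.strictMono.comp f.2⟩
        left_inv := fun f => by simp
        right_inv := fun f => by simp }
  simp only [reducedEuler, h]

/-- A strictly increasing sequence of length `n + 1` is its first term together with a strictly
increasing sequence of length `n` above it. -/
def strictMonoSuccEquiv (P : Type*) [Preorder P] (n : ℕ) :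
    { f : Fin (n + 1) → P // StrictMono f } ≃
      Σ x : P, { f : Fin n → { y : P // x < y } // StrictMono f } where
  toFun f := ⟨f.1 0, fun i => ⟨f.1 i.succ, f.2 (Fin.succ_pos i)⟩,
    fun _ _ hij => f.2 (Fin.succ_lt_succ_iff.2 hij)⟩
  invFun p := ⟨Fin.cons p.1 fun i => (p.2.1 i).1, by
    intro i j
    refine Fin.cases ?_ (fun i => ?_) i <;> refine Fin.cases ?_ (fun j => ?_) j
    · simp
    · intro _; simpa using (p.2.1 j).2
    · simp
    · intro hij; simpa using p.2.2 (Fin.succ_lt_succ_iff.1 hij)⟩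
  left_inv f := by
    ext i
    refine Fin.cases ?_ (fun i => ?_) i <;> simp
  right_inv _ := rfl

theorem card_strictMono_succ (P : Type*) [Preorder P] [Fintype P] (n : ℕ) :
    Nat.card { f : Fin (n + 1) → P // StrictMono f } =
      ∑ x : P, Nat.card { f : Fin n → { y : P // x < y } // StrictMono f } := by
  rw [Nat.card_congr (strictMonoSuccEquiv P n), Nat.card_sigma]

theorem card_strictMono_eq_zero (P : Type*) [Preorder P] [Finite P] {n : ℕ}
    (h : Nat.card P < n) : Nat.card { f : Fin n → P // StrictMono f } = 0 := by
  have : IsEmpty { f : Fin n → P // StrictMono f } := ⟨fun f => by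
    have := Nat.card_le_card_of_injective f.1 f.2.injective
    rw [Nat.card_fin] at this
    omega⟩
  exact Nat.card_of_isEmpty

theorem reducedEuler_eq_sum_range (P : Type*) [Preorder P] [Finite P] {N : ℕ}
    (h : Nat.card P ≤ N) :
    reducedEuler P = -1 + ∑ d ∈ Finset.range N,
      (-1 : ℚ) ^ d * (Nat.card { f : Fin (d + 1) → P // StrictMono f } : ℚ) := by
  rw [reducedEuler, finsum_eq_sum_of_support_subset]
  intro d hd
  rw [Finset.coe_range, Set.mem_Iio]
  by_contra! hN
  exact hd (by simp [card_strictMono_eq_zero P (show Nat.card P < d + 1 by omega)])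

theorem reducedEuler_eq_neg_sum_range (P : Type*) [Preorder P] [Finite P] {N : ℕ}
    (h : Nat.card P ≤ N) :
    reducedEuler P = - ∑ d ∈ Finset.range (N + 1),
      (-1 : ℚ) ^ d * (Nat.card { f : Fin d → P // StrictMono f } : ℚ) := by
  have h0 : Nat.card { f : Fin 0 → P // StrictMono f } = 1 := by
    have : Unique { f : Fin 0 → P // StrictMono f } :=
      ⟨⟨⟨Fin.elim0, fun i => i.elim0⟩⟩, fun f => Subsingleton.elim _ _⟩
    exact Nat.card_unique
  rw [reducedEuler_eq_sum_range P h, Finset.sum_range_succ', h0]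
  simp only [pow_succ, pow_zero, Nat.cast_one, mul_neg, mul_one, neg_mul, Finset.sum_neg_distrib]
  ring

theorem reducedEuler_eq_neg_one_sub_sum (P : Type*) [Preorder P] [Fintype P] :
    reducedEuler P = -1 - ∑ x : P, reducedEuler { y : P // x < y } := by
  have hx (x : P) : reducedEuler { y : P // x < y } =
      - ∑ d ∈ Finset.range (Nat.card P + 1),
        (-1 : ℚ) ^ d * (Nat.card { f : Fin d → { y : P // x < y } // StrictMono f } : ℚ) :=
    reducedEuler_eq_neg_sum_range _ (Nat.card_le_card_of_injective _ Subtype.val_injective)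
  rw [reducedEuler_eq_sum_range P (Nat.le_succ _)]
  simp only [hx, card_strictMono_succ, Nat.cast_sum, Finset.mul_sum, Finset.sum_neg_distrib]
  rw [Finset.sum_comm]
  ring

section Subgroups

variable {G : Type*} [Group G]

theorem mem_conjSub {H : Subgroup G} {g x : G} : x ∈ conjSub H g ↔ g⁻¹ * x * g ∈ H := by
  rw [conjSub, Subgroup.mem_map]
  constructor
  · rintro ⟨y, hy, rfl⟩
    simpa [mul_assoc] using hy
  · intro h
    exact ⟨_, h, by simp [mul_assoc]⟩

theorem conjSub_conjSub_inv (H : Subgroup G) (g : G) : conjSub (conjSub H g⁻¹) g = H := by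
  ext x
  simp [mem_conjSub, mul_assoc]

theorem conjSub_inv_conjSub (H : Subgroup G) (g : G) : conjSub (conjSub H g) g⁻¹ = H := by
  ext x
  simp [mem_conjSub, mul_assoc]

theorem conjSub_lt_conjSub {H K : Subgroup G} {g : G} :
    conjSub H g < conjSub K g ↔ H < K :=
  (MulAut.conj g).mapSubgroup.lt_iff_lt

theorem index_conjSub (H : Subgroup G) (g : G) : (conjSub H g).index = H.index :=
  Subgroup.index_map_equiv H (MulAut.conj g)

/-- Conjugation by `g` as a permutation of a conjugation-closed set of subgroups. -/
def conjEquiv {S : Set (Subgroup G)} (hS : ∀ H ∈ S, ∀ g : G, conjSub H g ∈ S) (g : G) :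
    S ≃ S where
  toFun K := ⟨conjSub K g, hS K K.2 g⟩
  invFun K := ⟨conjSub K g⁻¹, hS K K.2 g⁻¹⟩
  left_inv _ := Subtype.ext (conjSub_inv_conjSub _ _)
  right_inv _ := Subtype.ext (conjSub_conjSub_inv _ _)

theorem reducedEuler_conjSub {S : Set (Subgroup G)}
    (hS : ∀ H ∈ S, ∀ g : G, conjSub H g ∈ S) (H : Subgroup G) (g : G) :
    reducedEuler { L : Subgroup G // L ∈ S ∧ conjSub H g < L } =
      reducedEuler { L : Subgroup G // L ∈ S ∧ H < L } := by
  refine (reducedEuler_congr (RelIso.mk (Equiv.subtypeEquiv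
    (MulAut.conj g).mapSubgroup.toEquiv fun L => ?_) ?_)).symm
  · change _ ↔ conjSub L g ∈ S ∧ conjSub H g < conjSub L g
    rw [conjSub_lt_conjSub]
    refine and_congr_left fun _ => ⟨fun h => hS L h g, fun h => ?_⟩
    rw [← conjSub_inv_conjSub L g]
    exact hS _ h _
  · intro a b
    exact (MulAut.conj g).mapSubgroup.le_iff_le

/-- An equivariant map `G/H → G/K` is determined by the image of the coset `H`, which may be any
coset fixed by `H`. -/
noncomputable def orbitHomEquiv (H K : Subgroup G) :
    { f : G ⧸ H → G ⧸ K // ∀ (g : G) (x : G ⧸ H), f (g • x) = g • f x } ≃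
      { x : G ⧸ K | ∀ h ∈ H, h • x = x } where
  toFun f := ⟨f.1 (1 : G), fun h hh => by
    rw [← f.2]
    refine congrArg f.1 ?_
    change ((h * 1 : G) : G ⧸ H) = _
    rw [QuotientGroup.eq]
    simpa using hh⟩
  invFun x := ⟨fun y => Quotient.liftOn' y (fun g => g • x.1) fun a b hab => by
      have := x.2 _ (QuotientGroup.leftRel_apply.1 hab)
      change a • x.1 = b • x.1
      rw [mul_smul, inv_smul_eq_iff] at this
      exact this.symm, by
    intro g y
    induction y using QuotientGroup.induction_on with
    | H y => exact mul_smul g y x.1⟩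
  left_inv f := by
    ext y
    induction y using QuotientGroup.induction_on with
    | H y =>
      change y • f.1 (1 : G) = f.1 y
      rw [← f.2]
      refine congrArg f.1 ?_
      change ((y * 1 : G) : G ⧸ H) = _
      rw [mul_one]
  right_inv x := Subtype.ext (one_smul G x.1)

theorem smul_mk_eq_iff (K : Subgroup G) (h g : G) :
    h • (g : G ⧸ K) = g ↔ h ∈ conjSub K g := by
  change ((h * g : G) : G ⧸ K) = g ↔ _
  rw [eq_comm, QuotientGroup.eq, mem_conjSub, mul_assoc]

theorem card_mul_card_orbitHom (H K : Subgroup G) :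
    Nat.card K * Nat.card { f : G ⧸ H → G ⧸ K // ∀ (g : G) (x : G ⧸ H), f (g • x) = g • f x } =
      Nat.card { g : G // H ≤ conjSub K g } := by
  rw [Nat.card_congr (orbitHomEquiv H K), ← Nat.card_prod,
    ← Nat.card_congr (QuotientGroup.preimageMkEquivSubgroupProdSet K _)]
  refine Nat.card_congr (Equiv.subtypeEquivRight fun g => ?_)
  simp only [Set.mem_preimage, Set.mem_ofPred_eq, smul_mk_eq_iff]
  rfl

theorem finsum_card_orbitHom_mul [Finite G] {S : Set (Subgroup G)}
    (hS : ∀ H ∈ S, ∀ g : G, conjSub H g ∈ S) (k : Subgroup G → ℚ)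
    (hk : ∀ H ∈ S, ∀ g : G, k (conjSub H g) = k H) (H : Subgroup G) :
    ∑ᶠ K : S, (Nat.card { f : G ⧸ H → G ⧸ (K : Subgroup G) // ∀ (g : G) (x : G ⧸ H),
        f (g • x) = g • f x } : ℚ) * k K =
      ∑ᶠ K : S, if H ≤ K then ((K : Subgroup G).index : ℚ) * k K else 0 := by
  have := Fintype.ofFinite G
  have := Fintype.ofFinite S
  rw [finsum_eq_sum_of_fintype, finsum_eq_sum_of_fintype]
  have hG : (Nat.card G : ℚ) ≠ 0 := by exact_mod_cast Nat.card_pos.ne'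
  have hindex (K : Subgroup G) : (K.index : ℚ) = Nat.card G / Nat.card K := by
    rw [eq_div_iff (by exact_mod_cast Nat.card_pos.ne')]
    exact_mod_cast K.index_mul_card
  have hterm (K : S) : (Nat.card { f : G ⧸ H → G ⧸ (K : Subgroup G) //
      ∀ (g : G) (x : G ⧸ H), f (g • x) = g • f x } : ℚ) * k K =
      ∑ g : G, if H ≤ conjSub K g then
        ((conjSub (K : Subgroup G) g).index : ℚ) / Nat.card G * k (conjSub K g) else 0 := by
    have hK : (Nat.card K.1 : ℚ) ≠ 0 := by exact_mod_cast Nat.card_pos.ne'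
    have h := congrArg (Nat.cast : ℕ → ℚ) (card_mul_card_orbitHom H K.1)
    rw [Nat.cast_mul, Nat.card_eq_fintype_card (α := { g : G // H ≤ conjSub K.1 g }),
      Fintype.card_subtype] at h
    simp only [index_conjSub, hk K K.2]
    rw [← Finset.sum_filter, Finset.sum_const, nsmul_eq_mul, ← h, hindex]
    field_simp
  simp only [hterm]
  rw [Finset.sum_comm]
  have hg (g : G) : (∑ K : S, if H ≤ conjSub K g then
      ((conjSub (K : Subgroup G) g).index : ℚ) / Nat.card G * k (conjSub K g) else 0) =
      ∑ K : S, if H ≤ K then ((K : Subgroup G).index : ℚ) / Nat.card G * k K else 0 :=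
    Equiv.sum_comp (conjEquiv hS g) fun K : S =>
      if H ≤ K then ((K : Subgroup G).index : ℚ) / Nat.card G * k K else 0
  simp only [hg, Finset.sum_const, Finset.card_univ, nsmul_eq_mul, Finset.mul_sum,
    ← Nat.card_eq_fintype_card]
  refine Finset.sum_congr rfl fun K _ => ?_
  split_ifs
  · field_simp
  · simp

theorem finsum_ite_le_eq_add [Finite G] {S : Set (Subgroup G)} (F : Subgroup G → ℚ)
    {H : Subgroup G} (hH : H ∈ S) :
    ∑ᶠ K : S, (if H ≤ K then F K else 0) =
      F H + ∑ᶠ K : { L : Subgroup G // L ∈ S ∧ H < L }, F K := by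
  have := Fintype.ofFinite (Subgroup G)
  rw [finsum_eq_sum_of_fintype, finsum_eq_sum_of_fintype,
    ← Finset.sum_subtype (Finset.univ.filter (· ∈ S)) (by simp) fun K => if H ≤ K then F K else 0,
    ← Finset.sum_subtype (Finset.univ.filter fun L => L ∈ S ∧ H < L) (by simp) F,
    ← Finset.sum_filter, Finset.filter_filter, ← Finset.sum_insert (by simp)]
  refine Finset.sum_congr ?_ fun _ _ => rfl
  ext L
  simp only [Finset.mem_filter, Finset.mem_univ, true_and, Finset.mem_insert, le_iff_eq_or_lt]
  constructor
  · rintro ⟨hL, rfl | h⟩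
    · exact Or.inl rfl
    · exact Or.inr ⟨hL, h⟩
  · rintro (rfl | ⟨hL, h⟩)
    · exact ⟨hH, Or.inl rfl⟩
    · exact ⟨hL, Or.inr h⟩

theorem finsum_neg_reducedEuler [Finite G] (S : Set (Subgroup G)) {H : Subgroup G} (hH : H ∈ S) :
    ∑ᶠ K : S, (if H ≤ K then
      -reducedEuler { L : Subgroup G // L ∈ S ∧ (K : Subgroup G) < L } else 0) = 1 := by
  rw [finsum_ite_le_eq_add (fun K => -reducedEuler { L : Subgroup G // L ∈ S ∧ K < L }) hH]
  have := Fintype.ofFinite { L : Subgroup G // L ∈ S ∧ H < L }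
  rw [finsum_eq_sum_of_fintype, reducedEuler_eq_neg_one_sub_sum, Finset.sum_neg_distrib]
  have h (K : { L : Subgroup G // L ∈ S ∧ H < L }) : reducedEuler { y // K < y } =
      reducedEuler { L : Subgroup G // L ∈ S ∧ (K : Subgroup G) < L } :=
    reducedEuler_congr
      { toFun := fun y => ⟨y.1.1, y.1.2.1, y.2⟩
        invFun := fun y => ⟨⟨y.1, y.2.1, K.2.2.trans y.2.2⟩, y.2.2⟩
        left_inv := fun _ => rfl
        right_inv := fun _ => rfl
        map_rel_iff' := Iff.rfl }
  simp only [h]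
  ring

theorem eq_of_finsum_ite_le_eq [Finite G] {S : Set (Subgroup G)} {F F' : Subgroup G → ℚ}
    (h : ∀ H ∈ S, ∑ᶠ K : S, (if H ≤ K then F K else 0) =
      ∑ᶠ K : S, (if H ≤ K then F' K else 0)) : ∀ H ∈ S, F H = F' H := by
  intro H
  induction H using WellFoundedGT.induction with
  | ind H ih =>
    intro hH
    have := h H hH
    rw [finsum_ite_le_eq_add F hH, finsum_ite_le_eq_add F' hH,
      finsum_congr fun K : { L : Subgroup G // L ∈ S ∧ H < L } => ih K K.2.2 K.2.1] at this
    exact add_right_cancel this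

end Subgroups

/-- let `S` be a conjugation-closed set of subgroups of a finite
group `G`, and let `O_S` be the orbit category (objects `S`, morphisms the
`G`-maps `G/H → G/K`).  The skeletal weighting of `O_S` (the unique weighting
constant on isomorphism classes, i.e. on conjugacy classes of subgroups) is
`k(H) = −χ̃(S_{>H}) / [G:H]  ( = −μ_{S₊}(H,∞) / [G:H] )`. -/
theorem orbit_category_skeletal_weighting {G : Type*} [Group G] [Fintype G]
    (S : Set (Subgroup G))
    (hconj : ∀ H ∈ S, ∀ g : G, conjSub H g ∈ S)
    (k : Subgroup G → ℚ)
    (hk : ∀ H : Subgroup G,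
      k H = - reducedEuler { L : Subgroup G // L ∈ S ∧ H < L } / (H.index : ℚ)) :
    -- `k` is a weighting on the orbit category `O_S`
    (∀ H ∈ S, ∑ᶠ K : S,
        (Nat.card { f : G ⧸ H → G ⧸ (K : Subgroup G) // ∀ (g : G) (x : G ⧸ H),
            f (g • x) = g • f x } : ℚ) * k K = 1) ∧
    -- `k` is constant on isomorphism classes (conjugacy classes)
    (∀ H ∈ S, ∀ g : G, k (conjSub H g) = k H) ∧
    -- and it is the unique such weighting
    (∀ k' : Subgroup G → ℚ,
      (∀ H ∈ S, ∑ᶠ K : S,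
          (Nat.card { f : G ⧸ H → G ⧸ (K : Subgroup G) // ∀ (g : G) (x : G ⧸ H),
              f (g • x) = g • f x } : ℚ) * k' K = 1) →
      (∀ H ∈ S, ∀ g : G, k' (conjSub H g) = k' H) →
      ∀ H ∈ S, k' H = k H) := by
  have hindex (H : Subgroup G) : (H.index : ℚ) ≠ 0 := by
    exact_mod_cast Subgroup.index_ne_zero_of_finite
  have hkconj : ∀ H ∈ S, ∀ g : G, k (conjSub H g) = k H := fun H _ g => by
    rw [hk, hk, index_conjSub, reducedEuler_conjSub hconj]
  have hweight : ∀ H ∈ S, ∑ᶠ K : S,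
      (if H ≤ K then ((K : Subgroup G).index : ℚ) * k K else 0) = 1 := fun H hH => by
    simp only [hk, mul_div_cancel₀ _ (hindex _)]
    exact finsum_neg_reducedEuler S hH
  refine ⟨fun H hH => ?_, hkconj, fun k' hk' hk'conj H hH => ?_⟩
  · rw [finsum_card_orbitHom_mul hconj k hkconj, hweight H hH]
  · refine mul_left_cancel₀ (hindex H) (eq_of_finsum_ite_le_eq (S := S)
      (F := fun K => (K.index : ℚ) * k' K) (F' := fun K => (K.index : ℚ) * k K) ?_ H hH)
    intro H hH
    rw [hweight H hH, ← finsum_card_orbitHom_mul hconj k' hk'conj, hk' H hH]
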